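/- (Lorentz-space case of the paper's Theorem 2(i).) Let $\zeta:[0,1]\to[0,\infty)$ be a concave, non-decreasing function vanishing only at the origin such that $\lim_{t\to 0_+}\zeta(t)/\tau(t)=0$. Then the Lorentz space $\Lambda_\zeta$ does not embed continuously into $QA_{\varphi,\psi}$: there is no constant $K>0$ such that $\|f\|_{\varphi,\psi}\le K\,\|f\|_{\Lambda_\zeta}$ for every simple function $f$ on $[0,1]$. -/

import Mathlib

open MeasureTheory ENNReal Set Filter Topology

noncomputable section

/-- Lebesgue measure restricted to the interval `[0,1]`. -/
def μ01 : Measure ℝ := volume.restrict (Set.Icc 0 1)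

/-- `φ : [0,1] → [0,∞)` is concave, non-decreasing, and vanishes only at the origin. -/
structure IsPhi (φ : ℝ → ℝ) : Prop where
  concave : ConcaveOn ℝ (Set.Icc 0 1) φ
  mono : MonotoneOn φ (Set.Icc 0 1)
  zero : φ 0 = 0
  pos : ∀ t : ℝ, 0 < t → t ≤ 1 → 0 < φ t

/-- `ψ : [0,∞) → [0,∞)` is concave, non-decreasing, and vanishes only at the origin. -/
structure IsPsi (ψ : ℝ → ℝ) : Prop where
  concave : ConcaveOn ℝ (Set.Ici 0) ψ
  mono : MonotoneOn ψ (Set.Ici 0)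
  zero : ψ 0 = 0
  pos : ∀ t : ℝ, 0 < t → 0 < ψ t

/-- A sequence `g` of nonnegative `L^∞` functions with `|f| ≤ ∑ₙ gₙ` a.e. -/
def Admissible (f : ℝ → ℝ) (g : ℕ → ℝ → ℝ) : Prop :=
  (∀ n, AEMeasurable (g n) μ01) ∧
  (∀ n, eLpNorm (g n) ⊤ μ01 < ⊤) ∧
  (∀ n x, 0 ≤ g n x) ∧
  (∀ᵐ x ∂μ01, ENNReal.ofReal |f x| ≤ ∑' n : ℕ, ENNReal.ofReal (g n x))

/-- The cost `∑ₙ ψ(n) ‖gₙ‖_∞ φ(‖gₙ‖₁/‖gₙ‖_∞)` of a decomposition (index shifted by 1;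
`0/0 = 0` by the `ℝ≥0∞` division convention, and `φ 0 = 0`). -/
def seqCost (φ ψ : ℝ → ℝ) (g : ℕ → ℝ → ℝ) : ℝ≥0∞ :=
  ∑' n : ℕ, ENNReal.ofReal
    (ψ ((n : ℝ) + 1) * (eLpNorm (g n) ⊤ μ01).toReal *
      φ ((eLpNorm (g n) 1 μ01 / eLpNorm (g n) ⊤ μ01).toReal))

/-- The quasi-norm `‖f‖_{φ,ψ}` (equal to `∞` when no admissible decomposition exists). -/
def QANorm (φ ψ : ℝ → ℝ) (f : ℝ → ℝ) : ℝ≥0∞ :=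
  ⨅ (g : ℕ → ℝ → ℝ) (_ : Admissible f g), seqCost φ ψ g

/-- Membership in the space `QA_{φ,ψ}`. -/
def MemQA (φ ψ : ℝ → ℝ) (f : ℝ → ℝ) : Prop :=
  AEMeasurable f μ01 ∧ QANorm φ ψ f < ⊤

/-- The decreasing rearrangement `f*` of `f` on `[0,1]`. -/
def decRearr (f : ℝ → ℝ) (t : ℝ) : ℝ :=
  sInf {s : ℝ | 0 ≤ s ∧ μ01 {x | s < |f x|} ≤ ENNReal.ofReal t}

/-- The limit `ζ(0⁺)` of a non-decreasing function `ζ` on `[0,1]`. -/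
def limZero (ζ : ℝ → ℝ) : ℝ := sInf (ζ '' Set.Ioc 0 1)

/-- The Lorentz norm `‖f‖_{Λ_ζ} = ∫₀¹ f* dζ = ‖f‖_∞ ζ(0⁺) + ∫₀¹ f*(s) ζ'(s) ds`
(for `ζ` concave the derivative exists a.e. and `ζ` is absolutely continuous on `(0,1]`). -/
def lorentzNorm (ζ : ℝ → ℝ) (f : ℝ → ℝ) : ℝ≥0∞ :=
  eLpNorm f ⊤ μ01 * ENNReal.ofReal (limZero ζ) +
    ∫⁻ s in Set.Ioc (0:ℝ) 1, ENNReal.ofReal (decRearr f s * deriv ζ s)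

/-- Membership in the Lorentz space `Λ_ζ`. -/
def MemLorentz (ζ : ℝ → ℝ) (f : ℝ → ℝ) : Prop :=
  AEMeasurable f μ01 ∧ lorentzNorm ζ f < ⊤

/-- The quasi-concave function `φ_s(t) = inf_n max{sₙ,t} (φ(sₙ)/sₙ) ψ(n)` (index shifted by 1). -/
def phiSeq (φ ψ : ℝ → ℝ) (s : ℕ → ℝ) (t : ℝ) : ℝ :=
  if t = 0 then 0 else ⨅ n : ℕ, max (s n) t * (φ (s n) / s n) * ψ ((n : ℝ) + 1)

/-- The function `τ(t) = φ(t) ψ(logbar(φ(t)/t))` with `logbar t = 1 + log⁺ t`. -/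
def tauF (φ ψ : ℝ → ℝ) (t : ℝ) : ℝ :=
  if t = 0 then 0 else φ t * ψ (1 + max (Real.log (φ t / t)) 0)

/-- Auxiliary ratio. -/
def ratR (φ : ℝ → ℝ) (s t : ℝ) : ℝ := min 1 (s / t) * φ t / φ s

lemma IsPhi.slope {φ : ℝ → ℝ} (h : IsPhi φ) {s t : ℝ} (hs : 0 < s) (hst : s ≤ t) (ht : t ≤ 1) :
    s * φ t ≤ t * φ s := by
  have ht0 : 0 < t := hs.trans_le hst
  have h1 := h.concave.2 (show t ∈ Set.Icc (0:ℝ) 1 from ⟨ht0.le, ht⟩)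
    (show (0:ℝ) ∈ Set.Icc (0:ℝ) 1 from ⟨le_rfl, zero_le_one⟩)
    (show 0 ≤ s / t by positivity)
    (show 0 ≤ 1 - s / t by rw [sub_nonneg, div_le_one ht0]; exact hst) (by ring)
  simp only [smul_eq_mul, h.zero, mul_zero, add_zero] at h1
  rw [div_mul_cancel₀ _ ht0.ne'] at h1
  have h2 := mul_le_mul_of_nonneg_left h1 ht0.le
  calc s * φ t = t * (s / t * φ t) := by field_simp
    _ ≤ _ := h2

lemma IsPhi.nonneg {φ : ℝ → ℝ} (h : IsPhi φ) {s : ℝ} (hs : 0 ≤ s) (hs1 : s ≤ 1) : 0 ≤ φ s := by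
  rcases hs.eq_or_lt with rfl | h0
  · exact h.zero.ge
  · exact (h.pos s h0 hs1).le

lemma ratR_nonneg {φ : ℝ → ℝ} (h : IsPhi φ) {s t : ℝ} (hs : 0 ≤ s) (hs1 : s ≤ 1) (ht : 0 < t)
    (ht1 : t ≤ 1) : 0 ≤ ratR φ s t := by
  have := h.nonneg hs hs1
  have := h.nonneg ht.le ht1
  unfold ratR
  positivity

lemma ratR_le_one {φ : ℝ → ℝ} (h : IsPhi φ) {s t : ℝ} (hs : 0 ≤ s) (hs1 : s ≤ 1) (ht : 0 < t)
    (ht1 : t ≤ 1) : ratR φ s t ≤ 1 := by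
  unfold ratR
  rcases hs.eq_or_lt with rfl | h0
  · simp [h.zero]
  have hp := h.pos s h0 hs1
  have hpt := h.pos t ht ht1
  rw [div_le_one hp]
  rcases le_total t s with hts | hst
  · calc min 1 (s / t) * φ t ≤ 1 * φ t := by gcongr; exact min_le_left _ _
      _ ≤ φ s := by rw [one_mul]; exact h.mono ⟨ht.le, ht1⟩ ⟨hs, hs1⟩ hts
  · calc min 1 (s / t) * φ t ≤ s / t * φ t := by gcongr; exact min_le_right _ _
      _ = (s * φ t) / t := by ring
      _ ≤ φ s := by rw [div_le_iff₀ ht, mul_comm (φ s)]; exact h.slope h0 hst ht1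

/-- Power-type decay of `φ`. -/
lemma pow_decay {φ : ℝ → ℝ} (h : IsPhi φ) {c p : ℝ} (hc : 0 < c) (hp1 : p ≤ 1)
    (hreg : MonotoneOn (fun t => φ t / t ^ c) (Set.Ioc 0 p)) {s t D : ℝ} (hs : 0 < s)
    (hst : s ≤ t) (ht : t ≤ p) (hD : 0 < D) (hM : D * (φ t / t) ≤ φ s / s) :
    φ s / φ t ≤ D ^ (-c) := by
  have ht0 : 0 < t := hs.trans_le hst
  have hps := h.pos s hs (by linarith)
  have hpt := h.pos t ht0 (by linarith)
  have h1 : φ s / s ^ c ≤ φ t / t ^ c := hreg ⟨hs, by linarith⟩ ⟨ht0, ht⟩ hst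
  have h2 : φ s ≤ φ t := h.mono ⟨hs.le, by linarith⟩ ⟨ht0.le, by linarith⟩ hst
  have hsc : 0 < s ^ c := Real.rpow_pos_of_pos hs c
  have htc : 0 < t ^ c := Real.rpow_pos_of_pos ht0 c
  have h3 : φ s / φ t ≤ (s / t) ^ c := by
    rw [Real.div_rpow hs.le ht0.le, div_le_div_iff₀ hpt htc]
    rw [div_le_div_iff₀ hsc htc] at h1
    linarith
  refine h3.trans ?_
  rw [Real.rpow_neg hD.le, ← Real.inv_rpow hD.le]
  apply Real.rpow_le_rpow (by positivity) _ hc.le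
  rw [← one_div, div_le_div_iff₀ ht0 hD, one_mul]
  have h4 : D * φ t * s ≤ φ s * t := by
    rw [← mul_div_assoc, div_le_div_iff₀ ht0 hs] at hM
    exact hM
  have h5 : D * φ t * s ≤ φ t * t := h4.trans (by gcongr)
  have h6 : φ t * (s * D) ≤ φ t * t := by linarith
  exact le_of_mul_le_mul_left h6 hpt

lemma ratR_mul {φ : ℝ → ℝ} (h : IsPhi φ) {c p : ℝ} (hc : 0 < c) (hc1 : c < 1) (hp1 : p ≤ 1)
    (hreg : MonotoneOn (fun t => φ t / t ^ c) (Set.Ioc 0 p)) {s t u M : ℝ} (hs : 0 ≤ s)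
    (hs1 : s ≤ 1) (hu : 0 < u)
    (hut : u ≤ t) (ht : t ≤ p) (hM1 : 1 ≤ M) (hM : M * (φ t / t) ≤ φ u / u) :
    ratR φ s t * ratR φ s u ≤ M ^ (-c) := by
  have ht0 : 0 < t := hu.trans_le hut
  have hM0 : 0 < M := by linarith
  have ht1 : t ≤ 1 := by linarith
  have hu1 : u ≤ 1 := by linarith
  have hpt := h.pos t ht0 ht1
  have hpu := h.pos u hu hu1
  have r1 := ratR_le_one h hs hs1 ht0 ht1
  have r2 := ratR_le_one h hs hs1 hu hu1
  have n1 := ratR_nonneg h hs hs1 ht0 ht1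
  have n2 := ratR_nonneg h hs hs1 hu hu1
  rcases hs.eq_or_lt with rfl | h0
  · simp [ratR, h.zero]; positivity
  have hp := h.pos s h0 hs1
  have e2 : ∀ x, 0 < x → x ≤ 1 → ratR φ s x ≤ φ x / φ s := by
    intro x hx hx1
    have := h.pos x hx hx1
    unfold ratR
    gcongr
    calc min 1 (s / x) * φ x ≤ 1 * φ x := by gcongr; exact min_le_left _ _
      _ = φ x := one_mul _
  have e1 : ∀ x, 0 < x → x ≤ 1 → ratR φ s x ≤ (φ x / x) / (φ s / s) := by
    intro x hx hx1
    have := h.pos x hx hx1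
    unfold ratR
    calc min 1 (s / x) * φ x / φ s ≤ (s / x) * φ x / φ s := by gcongr; exact min_le_right _ _
      _ = _ := by field_simp
  rcases le_total t s with hts | hst
  · calc ratR φ s t * ratR φ s u ≤ 1 * (φ u / φ s) := by
          gcongr
          exact e2 u hu hu1
      _ ≤ φ u / φ t := by
          rw [one_mul]; gcongr; exact h.mono ⟨ht0.le, ht1⟩ ⟨hs, hs1⟩ hts
      _ ≤ _ := pow_decay h hc hp1 hreg hu hut ht hM0 hM
  rcases le_total s u with hsu | hus
  · calc ratR φ s t * ratR φ s u ≤ ((φ t / t) / (φ s / s)) * 1 := by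
          gcongr
          exact e1 t ht0 ht1
      _ ≤ (φ t / t) / (φ u / u) := by
          rw [mul_one]
          apply div_le_div_of_nonneg_left (by positivity) (by positivity)
          rw [div_le_div_iff₀ hu h0]; linarith [h.slope h0 hsu hu1]
      _ ≤ M⁻¹ := by
          rw [← one_div, div_le_div_iff₀ (by positivity) hM0]; linarith
      _ = M ^ (-1 : ℝ) := (Real.rpow_neg_one M).symm
      _ ≤ _ := Real.rpow_le_rpow_of_exponent_le hM1 (by linarith)
  · set D := (φ u / u) / (φ s / s) with hDdef
    have hD : 0 < D := by positivity
    have k1 : φ u / φ s ≤ D ^ (-c) := by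
      apply pow_decay h hc hp1 hreg hu hus (hst.trans ht) hD
      rw [hDdef]; field_simp; exact le_rfl
    set q := (φ t / t) / (φ s / s) with hq
    have hq0 : 0 < q := by positivity
    have k2 : ratR φ s t ≤ q ^ c := by
      rcases n1.eq_or_lt with h00 | h00
      · rw [← h00]; positivity
      calc ratR φ s t = ratR φ s t ^ (1:ℝ) := (Real.rpow_one _).symm
        _ ≤ ratR φ s t ^ c := Real.rpow_le_rpow_of_exponent_ge h00 r1 hc1.le
        _ ≤ q ^ c := Real.rpow_le_rpow n1 (e1 t ht0 ht1) hc.le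
    calc ratR φ s t * ratR φ s u ≤ q ^ c * D ^ (-c) := by
          gcongr
          exact (e2 u hu hu1).trans k1
      _ = (q / D) ^ c := by
          rw [Real.div_rpow hq0.le hD.le, Real.rpow_neg hD.le]; rfl
      _ ≤ (M⁻¹) ^ c := by
          apply Real.rpow_le_rpow (by positivity) _ hc.le
          rw [← one_div, div_le_div_iff₀ hD hM0, one_mul, hq, hDdef, div_mul_eq_mul_div]
          gcongr; linarith
      _ = M ^ (-c) := by rw [Real.rpow_neg hM0.le, Real.inv_rpow hM0.le]

/-- combinatorial splitting -/
lemma sum_le_of_pair (S : Finset ℕ) (r : ℕ → ℝ) (δ : ℝ) (hδ : 0 ≤ δ)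
    (h1 : ∀ i ∈ S, r i ≤ 1)
    (h : ∀ i ∈ S, ∀ j ∈ S, i ≠ j → r i * r j ≤ δ * δ) :
    (S.filter (fun i => δ < r i)).card ≤ 1 ∧ ∑ i ∈ S, r i ≤ 1 + S.card * δ := by
  have hc : (S.filter (fun i => δ < r i)).card ≤ 1 := by
    rw [Finset.card_le_one]
    intro a ha b hb
    rw [Finset.mem_filter] at ha hb
    by_contra hab
    have := h a ha.1 b hb.1 hab
    nlinarith [ha.2, hb.2]
  refine ⟨hc, ?_⟩
  rw [← Finset.sum_filter_add_sum_filter_not S (fun i => δ < r i)]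
  have a1 : ∑ i ∈ S.filter (fun i => δ < r i), r i ≤ 1 := by
    calc _ ≤ ∑ i ∈ S.filter (fun i => δ < r i), (1:ℝ) :=
          Finset.sum_le_sum (fun i hi => h1 i (Finset.mem_filter.1 hi).1)
      _ = (S.filter (fun i => δ < r i)).card := by simp
      _ ≤ 1 := by exact_mod_cast hc
  have a2 : ∑ i ∈ S.filter (fun i => ¬ δ < r i), r i ≤ S.card * δ := by
    calc _ ≤ ∑ i ∈ S.filter (fun i => ¬ δ < r i), δ :=
          Finset.sum_le_sum (fun i hi => not_lt.1 (Finset.mem_filter.1 hi).2)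
      _ = (S.filter (fun i => ¬ δ < r i)).card * δ := by simp
      _ ≤ _ := by gcongr; exact Finset.filter_subset _ _
  linarith

instance : IsProbabilityMeasure μ01 := ⟨by simp [μ01]⟩

lemma μ01_Ico {t : ℝ} (ht1 : t ≤ 1) : μ01 (Set.Ico 0 t) = ENNReal.ofReal t := by
  unfold μ01
  rw [Measure.restrict_apply measurableSet_Ico, Set.inter_eq_left.2]
  · simp
  · intro x hx
    exact ⟨hx.1, hx.2.le.trans ht1⟩

/-- The step function. -/
def stepF (N : ℕ) (a t : ℕ → ℝ) (x : ℝ) : ℝ :=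
  ∑ i ∈ Finset.range N, (Set.Ico 0 (t i)).indicator (fun _ => a i) x

lemma stepF_simple (N : ℕ) (a t : ℕ → ℝ) : ∃ F : SimpleFunc ℝ ℝ, ⇑F = stepF N a t := by
  induction N with
  | zero => exact ⟨0, by ext x; simp [stepF]⟩
  | succ n ih =>
    obtain ⟨F, hF⟩ := ih
    refine ⟨F + SimpleFunc.piecewise (Set.Ico 0 (t n)) measurableSet_Ico
      (SimpleFunc.const ℝ (a n)) 0, ?_⟩
    ext x
    rw [SimpleFunc.coe_add, hF]
    simp only [stepF, Finset.sum_range_succ, Pi.add_apply, SimpleFunc.coe_piecewise]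
    congr 1

lemma stepF_nonneg {N : ℕ} {a t : ℕ → ℝ} (ha : ∀ i, 0 ≤ a i) (x : ℝ) : 0 ≤ stepF N a t x :=
  Finset.sum_nonneg (fun i _ => Set.indicator_nonneg (fun _ _ => ha i) _)

lemma stepF_le {N : ℕ} {a t : ℕ → ℝ} (ha : ∀ i, 0 ≤ a i) (x : ℝ) :
    stepF N a t x ≤ ∑ i ∈ Finset.range N, a i :=
  Finset.sum_le_sum (fun i _ => Set.indicator_le_self' (fun _ _ => ha i) x)

lemma stepF_anti {N : ℕ} {a t : ℕ → ℝ} (ha : ∀ i, 0 ≤ a i) {x y : ℝ} (hx : 0 ≤ x) (hxy : x ≤ y) :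
    stepF N a t y ≤ stepF N a t x := by
  apply Finset.sum_le_sum
  intro i _
  by_cases hy : y ∈ Set.Ico 0 (t i)
  · rw [Set.indicator_of_mem hy, Set.indicator_of_mem (show x ∈ Set.Ico 0 (t i) from
      ⟨hx, hxy.trans_lt hy.2⟩)]
  · rw [Set.indicator_of_notMem hy]
    exact Set.indicator_nonneg (fun _ _ => ha i) _

lemma decRearr_stepF {N : ℕ} {a t : ℕ → ℝ} (ha : ∀ i, 0 ≤ a i) {s : ℝ} (hs : 0 < s) :
    decRearr (stepF N a t) s ≤ stepF N a t s := by
  apply csInf_le ⟨0, fun x hx => hx.1⟩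
  refine ⟨stepF_nonneg ha s, ?_⟩
  unfold μ01
  rw [Measure.restrict_apply' measurableSet_Icc]
  calc volume ({x | stepF N a t s < |stepF N a t x|} ∩ Set.Icc 0 1) ≤ volume (Set.Ico 0 s) := by
        apply measure_mono
        intro x hx
        refine ⟨hx.2.1, ?_⟩
        by_contra hcon
        have h1 := hx.1
        simp only [Set.mem_ofPred_eq, abs_of_nonneg (stepF_nonneg ha x)] at h1
        exact absurd (stepF_anti ha hs.le (not_lt.1 hcon)) (not_le.2 h1)
    _ = _ := by simp

lemma decRearr_nonneg (f : ℝ → ℝ) (s : ℝ) : 0 ≤ decRearr f s :=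
  Real.sInf_nonneg (fun _ hx => hx.1)

lemma lintegral_deriv_le {ζ : ℝ → ℝ} (hζ : IsPhi ζ) {t : ℝ} (ht : 0 < t) (ht1 : t ≤ 1) :
    ∫⁻ s in Set.Ioo 0 t, ENNReal.ofReal (deriv ζ s) ≤ ENNReal.ofReal (ζ t) := by
  have hm : MonotoneOn ζ (Set.uIcc 0 t) := by
    rw [Set.uIcc_of_le ht.le]
    exact hζ.mono.mono (Set.Icc_subset_Icc_right ht1)
  have hi := hm.intervalIntegrable_deriv
  have hv := hm.intervalIntegral_deriv_mem_uIcc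
  rw [hζ.zero, sub_zero, Set.uIcc_of_le (hζ.pos t ht ht1).le,
    intervalIntegral.integral_of_le ht.le, integral_Ioc_eq_integral_Ioo] at hv
  rw [intervalIntegrable_iff_integrableOn_Ioo_of_le ht.le] at hi
  rw [← ofReal_integral_eq_lintegral_ofReal hi]
  · exact ENNReal.ofReal_le_ofReal hv.2
  · rw [Filter.EventuallyLE, ae_restrict_iff' measurableSet_Ioo]
    refine Eventually.of_forall fun x hx => ?_
    have hn : Set.Icc (0:ℝ) 1 ∈ 𝓝 x := Icc_mem_nhds hx.1 (hx.2.trans_le ht1)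
    rw [Pi.zero_apply, ← derivWithin_of_mem_nhds hn]
    exact hζ.mono.derivWithin_nonneg

lemma limZero_le {ζ : ℝ → ℝ} (hζ : IsPhi ζ) {t : ℝ} (ht : 0 < t) (ht1 : t ≤ 1) :
    limZero ζ ≤ ζ t := by
  apply csInf_le
  · refine ⟨0, ?_⟩
    rintro _ ⟨x, hx, rfl⟩
    exact (hζ.pos x hx.1 hx.2).le
  · exact ⟨t, ⟨ht, ht1⟩, rfl⟩

lemma lorentz_stepF {ζ : ℝ → ℝ} (hζ : IsPhi ζ) {N : ℕ} {a t : ℕ → ℝ} (ha : ∀ i, 0 ≤ a i)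
    (ht : ∀ i, 0 < t i) (ht1 : ∀ i, t i ≤ 1) :
    lorentzNorm ζ (stepF N a t) ≤ ENNReal.ofReal (2 * ∑ i ∈ Finset.range N, a i * ζ (t i)) := by
  have hz : ∀ i, 0 ≤ ζ (t i) := fun i => (hζ.pos _ (ht i) (ht1 i)).le
  have hS : 0 ≤ ∑ i ∈ Finset.range N, a i * ζ (t i) :=
    Finset.sum_nonneg fun i _ => mul_nonneg (ha i) (hz i)
  unfold lorentzNorm
  rw [two_mul, ENNReal.ofReal_add hS hS]
  gcongr
  · have h1 : eLpNorm (stepF N a t) ⊤ μ01 ≤ ENNReal.ofReal (∑ i ∈ Finset.range N, a i) := by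
      rw [eLpNorm_exponent_top]
      apply eLpNormEssSup_le_of_ae_bound
      refine Eventually.of_forall fun x => ?_
      rw [Real.norm_eq_abs, abs_of_nonneg (stepF_nonneg ha x)]
      exact stepF_le ha x
    calc _ ≤ ENNReal.ofReal (∑ i ∈ Finset.range N, a i) * ENNReal.ofReal (limZero ζ) := by gcongr
      _ = ENNReal.ofReal ((∑ i ∈ Finset.range N, a i) * limZero ζ) :=
          (ENNReal.ofReal_mul (Finset.sum_nonneg fun i _ => ha i)).symm
      _ ≤ _ := by
          apply ENNReal.ofReal_le_ofReal
          rw [Finset.sum_mul]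
          exact Finset.sum_le_sum fun i _ =>
            mul_le_mul_of_nonneg_left (limZero_le hζ (ht i) (ht1 i)) (ha i)
  · calc ∫⁻ s in Set.Ioc (0:ℝ) 1, ENNReal.ofReal (decRearr (stepF N a t) s * deriv ζ s)
        ≤ ∫⁻ s in Set.Ioc (0:ℝ) 1, ∑ i ∈ Finset.range N, (Set.Ioo 0 (t i)).indicator
            (fun s => ENNReal.ofReal (a i) * ENNReal.ofReal (deriv ζ s)) s := by
          apply setLIntegral_mono' measurableSet_Ioc
          intro s hs
          rw [ENNReal.ofReal_mul (decRearr_nonneg _ _)]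
          calc _ ≤ ENNReal.ofReal (stepF N a t s) * ENNReal.ofReal (deriv ζ s) := by
                gcongr
                exact decRearr_stepF ha hs.1
            _ = _ := by
                unfold stepF
                rw [ENNReal.ofReal_sum_of_nonneg (fun i _ =>
                  Set.indicator_nonneg (fun _ _ => ha i) _), Finset.sum_mul]
                apply Finset.sum_congr rfl
                intro i _
                by_cases h : s < t i
                · rw [Set.indicator_of_mem (show s ∈ Set.Ico 0 (t i) from ⟨hs.1.le, h⟩),
                    Set.indicator_of_mem (show s ∈ Set.Ioo 0 (t i) from ⟨hs.1, h⟩)]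
                · rw [Set.indicator_of_notMem (fun hh => h hh.2),
                    Set.indicator_of_notMem (fun hh => h hh.2)]
                  simp
      _ ≤ ∫⁻ s, ∑ i ∈ Finset.range N, (Set.Ioo 0 (t i)).indicator
            (fun s => ENNReal.ofReal (a i) * ENNReal.ofReal (deriv ζ s)) s :=
          setLIntegral_le_lintegral _ _
      _ = ∑ i ∈ Finset.range N, ∫⁻ s, (Set.Ioo 0 (t i)).indicator
            (fun s => ENNReal.ofReal (a i) * ENNReal.ofReal (deriv ζ s)) s := by
          apply lintegral_finsetSum
          intro i _
          apply Measurable.indicator _ measurableSet_Ioo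
          exact ((measurable_deriv ζ).ennreal_ofReal).const_mul _
      _ ≤ ∑ i ∈ Finset.range N, ENNReal.ofReal (a i * ζ (t i)) := by
          apply Finset.sum_le_sum
          intro i _
          rw [lintegral_indicator measurableSet_Ioo,
            lintegral_const_mul _ ((measurable_deriv ζ).ennreal_ofReal), ENNReal.ofReal_mul (ha i)]
          gcongr
          exact lintegral_deriv_le hζ (ht i) (ht1 i)
      _ = _ := (ENNReal.ofReal_sum_of_nonneg fun i _ => mul_nonneg (ha i) (hz i)).symm

/-- Basic data of one function. -/
lemma single_bound {φ : ℝ → ℝ} (h : IsPhi φ) {g : ℝ → ℝ} (hg : AEMeasurable g μ01)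
    (hf : eLpNorm g ⊤ μ01 < ⊤) (hg0 : ∀ x, 0 ≤ g x) :
    ∃ s : ℝ, s = (eLpNorm g 1 μ01 / eLpNorm g ⊤ μ01).toReal ∧ 0 ≤ s ∧ s ≤ 1 ∧
      ∀ t, 0 < t → t ≤ 1 → ENNReal.ofReal (φ t / t) * ∫⁻ x in Set.Ico 0 t, ENNReal.ofReal (g x) ∂μ01
        ≤ ENNReal.ofReal ((eLpNorm g ⊤ μ01).toReal * φ s * ratR φ s t) := by
  have hle : eLpNorm g 1 μ01 ≤ eLpNorm g ⊤ μ01 :=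
    eLpNorm_le_eLpNorm_of_exponent_le le_top hg.aestronglyMeasurable
  have hone : eLpNorm g 1 μ01 = ∫⁻ x, ENNReal.ofReal (g x) ∂μ01 := by
    rw [eLpNorm_one_eq_lintegral_enorm]
    congr 1; ext x
    exact Real.enorm_of_nonneg (hg0 x)
  have hsup : ∀ᵐ x ∂μ01, ENNReal.ofReal (g x) ≤ eLpNorm g ⊤ μ01 := by
    rw [eLpNorm_exponent_top]
    filter_upwards [ae_le_eLpNormEssSup (f := g) (μ := μ01)] with x hx
    rwa [Real.enorm_of_nonneg (hg0 x)] at hx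
  set H := eLpNorm g ⊤ μ01
  set I := eLpNorm g 1 μ01
  have hq1 : I / H ≤ 1 := ENNReal.div_le_of_le_mul (by simpa using hle)
  refine ⟨_, rfl, ENNReal.toReal_nonneg, ?_, ?_⟩
  · exact ENNReal.toReal_le_of_le_ofReal zero_le_one (by simpa using hq1)
  intro t ht ht1
  set s := (I / H).toReal with hs
  have hs0 : 0 ≤ s := ENNReal.toReal_nonneg
  have hs1 : s ≤ 1 := ENNReal.toReal_le_of_le_ofReal zero_le_one (by simpa using hq1)
  set η := H.toReal with hη
  have hη0 : 0 ≤ η := ENNReal.toReal_nonneg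
  have hIfin : I ≠ ⊤ := (hle.trans_lt hf).ne
  have hIe : I = ENNReal.ofReal (η * s) := by
    rw [hη, hs, ← ENNReal.toReal_mul]
    by_cases hH : H = 0
    · have : I = 0 := le_antisymm (hH ▸ hle) bot_le
      simp [this]
    · rw [ENNReal.mul_div_cancel hH hf.ne, ENNReal.ofReal_toReal hIfin]
  have b1 : ∫⁻ x in Set.Ico 0 t, ENNReal.ofReal (g x) ∂μ01 ≤ ENNReal.ofReal (η * s) := by
    rw [← hIe, hone]; exact setLIntegral_le_lintegral _ _
  have b2 : ∫⁻ x in Set.Ico 0 t, ENNReal.ofReal (g x) ∂μ01 ≤ ENNReal.ofReal (η * t) := by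
    calc _ ≤ ∫⁻ x in Set.Ico 0 t, H ∂μ01 := lintegral_mono_ae (ae_restrict_of_ae hsup)
      _ = H * ENNReal.ofReal t := by rw [setLIntegral_const, μ01_Ico ht1]
      _ = _ := by rw [ENNReal.ofReal_mul hη0, hη, ENNReal.ofReal_toReal hf.ne]
  have hpt := h.pos t ht ht1
  have b3 : ∫⁻ x in Set.Ico 0 t, ENNReal.ofReal (g x) ∂μ01 ≤ ENNReal.ofReal (η * min t s) := by
    rcases min_cases t s with ⟨e, _⟩ | ⟨e, _⟩ <;> rw [e] <;> assumption
  calc _ ≤ ENNReal.ofReal (φ t / t) * ENNReal.ofReal (η * min t s) := by gcongr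
    _ = ENNReal.ofReal (φ t / t * (η * min t s)) := (ENNReal.ofReal_mul (by positivity)).symm
    _ ≤ _ := by
      apply ENNReal.ofReal_le_ofReal
      rcases hs0.eq_or_lt with e | e
      · rw [← e, min_eq_right ht.le]; simp [h.zero]
      have hps := h.pos s e hs1
      have : min t s = t * min 1 (s / t) := by
        rw [mul_min_of_nonneg _ _ ht.le, mul_one, mul_div_cancel₀ _ ht.ne']
      rw [this]
      unfold ratR
      apply le_of_eq
      field_simp

lemma IsPsi.le_mul {ψ : ℝ → ℝ} (h : IsPsi ψ) {m : ℝ} (hm : 1 ≤ m) : ψ m ≤ m * ψ 1 := by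
  have hm0 : 0 < m := by linarith
  have h1 := h.concave.2 (show m ∈ Set.Ici (0:ℝ) from hm0.le)
    (show (0:ℝ) ∈ Set.Ici (0:ℝ) from Set.self_mem_Ici)
    (show 0 ≤ 1 / m by positivity)
    (show 0 ≤ 1 - 1 / m by rw [sub_nonneg, div_le_one hm0]; exact hm) (by ring)
  simp only [smul_eq_mul, h.zero, mul_zero, add_zero] at h1
  rw [div_mul_cancel₀ _ hm0.ne'] at h1
  have h2 := mul_le_mul_of_nonneg_left h1 hm0.le
  calc ψ m = m * (1 / m * ψ m) := by field_simp
    _ ≤ _ := h2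

lemma qa_lower {φ ψ : ℝ → ℝ} (hφ : IsPhi φ) (hψ : IsPsi ψ) {m : ℕ} (hm : 1 ≤ m) {t : ℕ → ℝ}
    (ht : ∀ i, 0 < t i) (ht1 : ∀ i, t i ≤ 1) {δ : ℝ} (hδ : 0 ≤ δ)
    (hpair : ∀ s, 0 ≤ s → s ≤ 1 → ∀ i ∈ Finset.range (2 * m), ∀ j ∈ Finset.range (2 * m), i ≠ j →
      ratR φ s (t i) * ratR φ s (t j) ≤ δ * δ)
    (hmδ : 2 * (m : ℝ) ^ 2 * δ ≤ 1) (g : ℕ → ℝ → ℝ)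
    (hg : Admissible (stepF (2 * m) (fun i => 1 / φ (t i)) t) g) :
    ENNReal.ofReal (m * ψ m / 2) ≤ seqCost φ ψ g := by
  obtain ⟨hgm, hgf, hg0, hgd⟩ := hg
  have hpφ : ∀ i, 0 < φ (t i) := fun i => hφ.pos _ (ht i) (ht1 i)
  have hmR : (1:ℝ) ≤ m := by exact_mod_cast hm
  have hψm : 0 < ψ m := hψ.pos _ (by linarith)
  have hψ1 : 0 < ψ 1 := hψ.pos _ one_pos
  choose s hsdef hs0 hs1 hsb using fun n => single_bound hφ (hgm n) (hgf n) (hg0 n)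
  set η : ℕ → ℝ := fun n => (eLpNorm (g n) ⊤ μ01).toReal with hη
  have hη0 : ∀ n, 0 ≤ η n := fun n => ENNReal.toReal_nonneg
  set S := Finset.range (2 * m) with hS
  have hcomb := fun n => sum_le_of_pair S (fun i => ratR φ (s n) (t i)) δ hδ
    (fun i _ => ratR_le_one hφ (hs0 n) (hs1 n) (ht i) (ht1 i)) (hpair (s n) (hs0 n) (hs1 n))
  have hRn : ∀ n i, 0 ≤ ratR φ (s n) (t i) :=
    fun n i => ratR_nonneg hφ (hs0 n) (hs1 n) (ht i) (ht1 i)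
  set Bd := (Finset.range m).biUnion (fun n => S.filter (fun i => δ < ratR φ (s n) (t i))) with hBd
  have hBdc : Bd.card ≤ m := by
    calc Bd.card ≤ ∑ n ∈ Finset.range m, (S.filter (fun i => δ < ratR φ (s n) (t i))).card :=
          Finset.card_biUnion_le
      _ ≤ ∑ n ∈ Finset.range m, 1 := Finset.sum_le_sum fun n _ => (hcomb n).1
      _ = m := by simp
  set G := S \ Bd with hG
  have hGS : G ⊆ S := Finset.sdiff_subset
  have hGc : m ≤ G.card := by
    have := Finset.le_card_sdiff Bd S
    have h2 : S.card = 2 * m := by simp [hS]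
    rw [← hG] at this
    omega
  have hGc2 : (G.card : ℝ) ≤ 2 * m := by
    have := Finset.card_le_card hGS
    rw [hS, Finset.card_range] at this
    exact_mod_cast this
  -- per-n estimate of the sum of ratios
  have hψmono : ∀ n : ℕ, ψ 1 ≤ ψ ((n:ℝ) + 1) := fun n =>
    hψ.mono (by simp) (show (0:ℝ) ≤ _ by positivity) (by simp)
  have hmul := hψ.le_mul hmR
  have hsum : ∀ n, ∑ i ∈ G, ratR φ (s n) (t i) ≤ 2 / ψ m * ψ ((n:ℝ) + 1) := by
    intro n
    rw [div_mul_eq_mul_div, le_div_iff₀ hψm]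
    rcases lt_or_ge n m with hn | hn
    · have h1 : ∑ i ∈ G, ratR φ (s n) (t i) ≤ 2 * m * δ := by
        calc _ ≤ ∑ i ∈ G, δ := by
              apply Finset.sum_le_sum
              intro i hi
              rw [hG, Finset.mem_sdiff] at hi
              by_contra hcon
              apply hi.2
              rw [hBd, Finset.mem_biUnion]
              exact ⟨n, Finset.mem_range.2 hn, Finset.mem_filter.2 ⟨hi.1, not_le.1 hcon⟩⟩
          _ = G.card * δ := by simp
          _ ≤ _ := by gcongr
      calc _ ≤ 2 * m * δ * (m * ψ 1) := by gcongr
        _ = 2 * (m:ℝ) ^ 2 * δ * ψ 1 := by ring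
        _ ≤ 1 * ψ 1 := by gcongr
        _ ≤ _ := by linarith [hψmono n]
    · have h1 : ∑ i ∈ G, ratR φ (s n) (t i) ≤ 2 := by
        calc _ ≤ ∑ i ∈ S, ratR φ (s n) (t i) :=
              Finset.sum_le_sum_of_subset_of_nonneg hGS fun i _ _ => hRn n i
          _ ≤ 1 + S.card * δ := (hcomb n).2
          _ = 1 + 2 * m * δ := by rw [hS, Finset.card_range]; push_cast; ring
          _ ≤ 1 + 2 * (m:ℝ) ^ 2 * δ := by
              gcongr
              nlinarith
          _ ≤ 2 := by linarith
      have h2 : ψ m ≤ ψ ((n:ℝ) + 1) := by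
        have : (m:ℝ) ≤ n := by exact_mod_cast hn
        exact hψ.mono (show (0:ℝ) ≤ _ by positivity) (show (0:ℝ) ≤ _ by positivity) (by linarith)
      gcongr
  -- the pairing
  have hlow : (m : ℝ≥0∞) ≤ ∑ i ∈ G, ENNReal.ofReal (φ (t i) / t i) *
      ∫⁻ x in Set.Ico 0 (t i), ∑' n, ENNReal.ofReal (g n x) ∂μ01 := by
    calc (m : ℝ≥0∞) ≤ ∑ i ∈ G, (1:ℝ≥0∞) := by
          rw [Finset.sum_const, nsmul_eq_mul, mul_one]; exact_mod_cast hGc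
      _ ≤ _ := by
          apply Finset.sum_le_sum
          intro i hi
          have e1 : ∫⁻ x in Set.Ico 0 (t i), ENNReal.ofReal (1 / φ (t i)) ∂μ01 ≤
              ∫⁻ x in Set.Ico 0 (t i), ∑' n, ENNReal.ofReal (g n x) ∂μ01 := by
            apply lintegral_mono_ae
            rw [ae_restrict_iff' measurableSet_Ico]
            filter_upwards [hgd] with x hx hxt
            refine le_trans (ENNReal.ofReal_le_ofReal ?_) hx
            refine le_trans ?_ (le_abs_self _)
            unfold stepF
            have := Finset.single_le_sum (f := fun i => (Set.Ico 0 (t i)).indicator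
              (fun _ => 1 / φ (t i)) x) (s := Finset.range (2 * m))
              (fun j _ => Set.indicator_nonneg (fun _ _ => (one_div_pos.2 (hpφ j)).le) _) (hGS hi)
            rwa [Set.indicator_of_mem hxt] at this
          rw [setLIntegral_const, μ01_Ico (ht1 i)] at e1
          calc (1:ℝ≥0∞) = ENNReal.ofReal (φ (t i) / t i) *
                (ENNReal.ofReal (1 / φ (t i)) * ENNReal.ofReal (t i)) := by
                have := hpφ i
                have := ht i
                rw [← ENNReal.ofReal_mul (by positivity), ← ENNReal.ofReal_mul (by positivity)]
                rw [← ENNReal.ofReal_one]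
                congr 1
                field_simp
            _ ≤ _ := by gcongr
  have hup : ∑ i ∈ G, ENNReal.ofReal (φ (t i) / t i) *
      ∫⁻ x in Set.Ico 0 (t i), ∑' n, ENNReal.ofReal (g n x) ∂μ01 ≤
      ENNReal.ofReal (2 / ψ m) * seqCost φ ψ g := by
    calc _ = ∑ i ∈ G, ∑' n, ENNReal.ofReal (φ (t i) / t i) *
            ∫⁻ x in Set.Ico 0 (t i), ENNReal.ofReal (g n x) ∂μ01 := by
          apply Finset.sum_congr rfl
          intro i _
          rw [lintegral_tsum (fun n => ((hgm n).restrict).ennreal_ofReal), ENNReal.tsum_mul_left]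
      _ = ∑' n, ∑ i ∈ G, ENNReal.ofReal (φ (t i) / t i) *
            ∫⁻ x in Set.Ico 0 (t i), ENNReal.ofReal (g n x) ∂μ01 :=
          (Summable.tsum_finsetSum (fun i _ => ENNReal.summable)).symm
      _ ≤ ∑' n : ℕ, ENNReal.ofReal (2 / ψ m) * ENNReal.ofReal
            (ψ ((n : ℝ) + 1) * η n * φ (s n)) := by
          apply ENNReal.tsum_le_tsum
          intro n
          have hφs := hφ.nonneg (hs0 n) (hs1 n)
          have := hη0 n
          calc _ ≤ ∑ i ∈ G, ENNReal.ofReal (η n * φ (s n) * ratR φ (s n) (t i)) :=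
                Finset.sum_le_sum fun i _ => hsb n (t i) (ht i) (ht1 i)
            _ = ENNReal.ofReal (η n * φ (s n) * ∑ i ∈ G, ratR φ (s n) (t i)) := by
                rw [Finset.mul_sum, ENNReal.ofReal_sum_of_nonneg]
                intro i _
                have := hRn n i
                positivity
            _ ≤ ENNReal.ofReal (η n * φ (s n) * (2 / ψ m * ψ ((n:ℝ) + 1))) := by
                apply ENNReal.ofReal_le_ofReal
                gcongr
                exact hsum n
            _ = _ := by
                rw [← ENNReal.ofReal_mul (by positivity)]
                congr 1; ring
      _ = ENNReal.ofReal (2 / ψ m) * seqCost φ ψ g := by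
          rw [ENNReal.tsum_mul_left]
          unfold seqCost
          simp only [hsdef, hη]
  have hfin := hlow.trans hup
  calc ENNReal.ofReal (m * ψ m / 2) = ENNReal.ofReal (ψ m / 2) * m := by
        rw [← ENNReal.ofReal_natCast, ← ENNReal.ofReal_mul (by positivity)]
        congr 1; ring
    _ ≤ ENNReal.ofReal (ψ m / 2) * (ENNReal.ofReal (2 / ψ m) * seqCost φ ψ g) := by gcongr
    _ = seqCost φ ψ g := by
        rw [← mul_assoc, ← ENNReal.ofReal_mul (by positivity)]
        rw [show ψ m / 2 * (2 / ψ m) = 1 by field_simp]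
        simp

lemma exists_slope {φ : ℝ → ℝ} (h : IsPhi φ)
    (hφslope : Tendsto (fun t => φ t / t) (𝓝[>] 0) atTop) {t0 y : ℝ} (h0 : 0 < t0) (h1 : t0 < 1)
    (hy : φ t0 / t0 ≤ y) : ∃ t, 0 < t ∧ t ≤ t0 ∧ φ t / t = y := by
  obtain ⟨u, hu1, hu⟩ := ((hφslope.eventually_ge_atTop y).and
    (Ioo_mem_nhdsGT h0)).exists
  have hcont : ContinuousOn φ (Set.Ioo 0 1) := by
    have := h.concave.continuousOn_interior
    rwa [interior_Icc] at this
  have hc2 : ContinuousOn (fun t => φ t / t) (Set.Icc u t0) := by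
    apply ContinuousOn.div
    · exact hcont.mono fun x hx => ⟨hu.1.trans_le hx.1, hx.2.trans_lt h1⟩
    · exact continuousOn_id
    · intro x hx
      exact (hu.1.trans_le hx.1).ne'
  obtain ⟨x, hx, hxy⟩ := intermediate_value_Icc' hu.2.le hc2 ⟨hy, hu1⟩
  exact ⟨x, hu.1.trans_le hx.1, hx.2, hxy⟩

lemma slope_lt {φ : ℝ → ℝ} (h : IsPhi φ) {u t : ℝ} (hu : 0 < u) (hu1 : u ≤ 1) (ht : 0 < t)
    (hlt : φ t / t < φ u / u) : u ≤ t := by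
  by_contra hcon
  have := h.slope ht (not_le.1 hcon).le hu1
  rw [div_lt_div_iff₀ ht hu] at hlt
  linarith

/-- (Lorentz-space case of Theorem 2(i)) if `ζ` is a concave, non-decreasing
function vanishing only at the origin with `ζ(t)/τ(t) → 0` as `t → 0⁺`, then `Λ_ζ` does
not embed continuously into `QA_{φ,ψ}`: no `K > 0` satisfies
`‖f‖_{φ,ψ} ≤ K ‖f‖_{Λ_ζ}` for every simple function `f`. -/
theorem stmt17 {φ ψ : ℝ → ℝ} (hφ : IsPhi φ) (hψ : IsPsi ψ)
    (hφ0 : Tendsto φ (𝓝[>] 0) (𝓝 0))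
    (hφslope : Tendsto (fun t => φ t / t) (𝓝[>] 0) atTop)
    (c p : ℝ) (hc : 0 < c) (hc1 : c < 1) (hp : 0 < p) (hp1 : p ≤ 1)
    (hreg : MonotoneOn (fun t => φ t / t ^ c) (Set.Ioc 0 p))
    (C : ℝ) (hC : 1 ≤ C) (hψC : ∀ n : ℕ, 1 ≤ n → ψ ((n : ℝ) ^ 2) ≤ C * ψ (n : ℝ))
    (ζ : ℝ → ℝ) (hζ : IsPhi ζ)
    (hlim : Tendsto (fun t => ζ t / tauF φ ψ t) (𝓝[>] 0) (𝓝 0)) :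
    ¬ ∃ K : ℝ, 0 < K ∧ ∀ f : SimpleFunc ℝ ℝ,
      QANorm φ ψ ⇑f ≤ ENNReal.ofReal K * lorentzNorm ζ ⇑f := by
  rintro ⟨K, hK, hall⟩
  have hC0 : 0 < C := by linarith
  set ε : ℝ := 1 / (16 * K * C ^ 2) with hε
  have hε0 : 0 < ε := by positivity
  -- choose the base point
  have ev1 : ∀ᶠ t in 𝓝[>] (0:ℝ), ζ t / tauF φ ψ t < ε := hlim.eventually_lt_const hε0
  obtain ⟨d, hd0, hd⟩ := mem_nhdsGT_iff_exists_Ioo_subset.1 ev1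
  have hd0 : 0 < d := hd0
  obtain ⟨t0, hA1, ht0⟩ := ((hφslope.eventually_ge_atTop 1).and
    (Ioo_mem_nhdsGT (lt_min hd0 hp))).exists
  have ht00 : 0 < t0 := ht0.1
  have ht0d : t0 < d := ht0.2.trans_le (min_le_left _ _)
  have ht0p : t0 < p := ht0.2.trans_le (min_le_right _ _)
  have ht01 : t0 < 1 := ht0p.trans_le hp1
  set A := φ t0 / t0 with hA
  -- choose m
  have evm1 : ∀ᶠ m : ℕ in atTop, 2 * (m:ℝ) ^ 2 * Real.exp (-(c * m / 2)) ≤ 1 := by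
    have h1 : Tendsto (fun x : ℝ => x ^ 2 * Real.exp (-x)) atTop (𝓝 0) :=
      Real.tendsto_pow_mul_exp_neg_atTop_nhds_zero 2
    have h2 : Tendsto (fun m : ℕ => c / 2 * (m:ℝ)) atTop atTop :=
      tendsto_natCast_atTop_atTop.const_mul_atTop (by positivity)
    have h3 := (h1.comp h2).eventually_lt_const (show (0:ℝ) < c ^ 2 / 8 by positivity)
    filter_upwards [h3] with m hm
    simp only [Function.comp] at hm
    have e : c / 2 * (m:ℝ) = c * m / 2 := by ring
    rw [e] at hm
    have : c ^ 2 / 8 * (2 * (m:ℝ) ^ 2 * Real.exp (-(c * m / 2))) ≤ c ^ 2 / 8 * 1 := by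
      nlinarith
    exact le_of_mul_le_mul_left this (by positivity)
  obtain ⟨m, hm1, hm2, hm3⟩ := (evm1.and ((eventually_ge_atTop 2).and
    ((tendsto_natCast_atTop_atTop (R := ℝ)).eventually_ge_atTop (1 + Real.log A)))).exists
  have hmR : (2:ℝ) ≤ m := by exact_mod_cast hm2
  have hex : ∀ i : ℕ, ∃ t, 0 < t ∧ t ≤ t0 ∧ φ t / t = A * Real.exp (m * i) := by
    intro i
    apply exists_slope hφ hφslope ht00 ht01
    have : 1 ≤ Real.exp (m * i) := Real.one_le_exp (by positivity)
    rw [← hA]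
    nlinarith
  choose t ht htt0 hte using hex
  have ht1 : ∀ i, t i ≤ 1 := fun i => (htt0 i).trans ht01.le
  have hψm : 0 < ψ m := hψ.pos _ (by linarith)
  have hpφ : ∀ i, 0 < φ (t i) := fun i => hφ.pos _ (ht i) (ht1 i)
  set δ := Real.exp (-(c * m / 2)) with hδ
  have hpair0 : ∀ s, 0 ≤ s → s ≤ 1 → ∀ i j : ℕ, i < j →
      ratR φ s (t i) * ratR φ s (t j) ≤ δ * δ := by
    intro s hs0 hs1 i j hij
    have hMle : Real.exp m * (φ (t i) / t i) ≤ φ (t j) / t j := by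
      rw [hte, hte]
      have : Real.exp m * Real.exp (m * i) ≤ Real.exp (m * j) := by
        rw [← Real.exp_add]
        apply Real.exp_le_exp.2
        have : (i:ℝ) + 1 ≤ j := by exact_mod_cast hij
        nlinarith
      nlinarith
    have hlt : φ (t i) / t i < φ (t j) / t j := by
      refine lt_of_lt_of_le ?_ hMle
      have h1 : 1 < Real.exp m := Real.one_lt_exp_iff.2 (by linarith)
      have h2 : 0 < φ (t i) / t i := div_pos (hpφ i) (ht i)
      nlinarith
    have hle := slope_lt hφ (ht j) (ht1 j) (ht i) hlt
    have := ratR_mul hφ hc hc1 hp1 hreg hs0 hs1 (ht j) hle ((htt0 i).trans ht0p.le)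
      (Real.one_le_exp (by positivity)) hMle
    refine this.trans (le_of_eq ?_)
    rw [hδ, ← Real.exp_add, ← Real.exp_mul]
    congr 1; ring
  have hpair : ∀ s, 0 ≤ s → s ≤ 1 → ∀ i ∈ Finset.range (2 * m), ∀ j ∈ Finset.range (2 * m),
      i ≠ j → ratR φ s (t i) * ratR φ s (t j) ≤ δ * δ := by
    intro s hs0 hs1 i _ j _ hij
    rcases lt_or_gt_of_ne hij with h | h
    · exact hpair0 s hs0 hs1 i j h
    · rw [mul_comm]; exact hpair0 s hs0 hs1 j i h
  have hlow := qa_lower hφ hψ (by omega : 1 ≤ m) ht ht1 (Real.exp_pos _).le hpair hm1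
  obtain ⟨F, hF⟩ := stepF_simple (2 * m) (fun i => 1 / φ (t i)) t
  have hQ : ENNReal.ofReal (m * ψ m / 2) ≤ QANorm φ ψ ⇑F := by
    rw [hF]
    exact le_iInf₂ hlow
  have hL := lorentz_stepF hζ (N := 2 * m) (a := fun i => 1 / φ (t i))
    (fun i => (one_div_pos.2 (hpφ i)).le) ht ht1
  rw [← hF] at hL
  -- bound the terms
  have hterm : ∀ i ∈ Finset.range (2 * m), 1 / φ (t i) * ζ (t i) ≤ ε * (C ^ 2 * ψ m) := by
    intro i hi
    have hi' : (i:ℝ) ≤ 2 * m := by exact_mod_cast (Finset.mem_range.1 hi).le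
    have h1 : ζ (t i) / tauF φ ψ (t i) < ε := hd ⟨ht i, (htt0 i).trans_lt ht0d⟩
    have hA0 : 0 < A := by linarith
    have hlogA : 0 ≤ Real.log A := Real.log_nonneg hA1
    have hlog : 1 + max (Real.log (φ (t i) / t i)) 0 ≤ ((m:ℝ) ^ 2) ^ 2 := by
      rw [hte, Real.log_mul hA0.ne' (Real.exp_pos _).ne', Real.log_exp,
        max_eq_left (by positivity)]
      have : (m:ℝ) * i ≤ m * (2 * m) := by gcongr
      have h4 : (4:ℝ) ≤ m ^ 2 := by nlinarith
      nlinarith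
    have hψle : ψ (1 + max (Real.log (φ (t i) / t i)) 0) ≤ C ^ 2 * ψ m := by
      calc _ ≤ ψ (((m:ℝ) ^ 2) ^ 2) :=
            hψ.mono (show (0:ℝ) ≤ _ by positivity) (show (0:ℝ) ≤ _ by positivity) hlog
        _ ≤ C * ψ ((m:ℝ) ^ 2) := by
            have := hψC (m ^ 2) (Nat.one_le_pow _ _ (by omega))
            push_cast at this
            exact this
        _ ≤ C * (C * ψ m) := by
            gcongr
            exact hψC m (by omega)
        _ = _ := by ring
    have hψpos : 0 < ψ (1 + max (Real.log (φ (t i) / t i)) 0) := hψ.pos _ (by positivity)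
    unfold tauF at h1
    rw [if_neg (ht i).ne', div_lt_iff₀ (mul_pos (hpφ i) hψpos)] at h1
    rw [one_div, inv_mul_le_iff₀ (hpφ i)]
    have hp3 := hpφ i
    calc ζ (t i) ≤ ε * (φ (t i) * ψ (1 + max (Real.log (φ (t i) / t i)) 0)) := h1.le
      _ ≤ ε * (φ (t i) * (C ^ 2 * ψ m)) := by gcongr
      _ = _ := by ring
  have hsum := Finset.sum_le_sum hterm
  rw [Finset.sum_const, Finset.card_range, nsmul_eq_mul] at hsum
  push_cast at hsum
  have hfin : ENNReal.ofReal (m * ψ m / 2) ≤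
      ENNReal.ofReal (K * (2 * (2 * m * (ε * (C ^ 2 * ψ m))))) := by
    refine hQ.trans ((hall F).trans ?_)
    rw [ENNReal.ofReal_mul hK.le]
    gcongr
    refine hL.trans (ENNReal.ofReal_le_ofReal ?_)
    gcongr
  rw [ENNReal.ofReal_le_ofReal_iff (by positivity)] at hfin
  have e : K * (2 * (2 * m * (ε * (C ^ 2 * ψ m)))) = m * ψ m / 4 := by
    rw [hε]; field_simp; norm_num
  rw [e] at hfin
  have : 0 < m * ψ m := by positivity
  linarith
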